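/- For every γ > 0 and t > 0, the variance of the GCP at squared Bessel time is ∑_{n=0}^∞ n² p̄_γ(n,t) − (c₁ γ t)² = c₂ γ t + 2γ (c₁ t)². -/

import Mathlib

noncomputable section
open MeasureTheory Real Finset

/-- The set Ω(k,n) of k-tuples (x₁,…,x_k) of nonnegative integers with
x₁ + 2x₂ + ⋯ + k x_k = n. -/
def Omega (k n : ℕ) : Finset (Fin k → ℕ) :=
  (Fintype.piFinset fun _ : Fin k => Finset.range (n + 1)).filter
    (fun x => ∑ j, (j.val + 1) * x j = n)

/-- The state probabilities of the generalized counting process. -/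
def gcp (k : ℕ) (l : Fin k → ℝ) (n : ℕ) (t : ℝ) : ℝ :=
  ∑ x ∈ Omega k n, ∏ j, ((l j * t) ^ (x j) / (Nat.factorial (x j) : ℝ) *
    Real.exp (-(l j * t)))

/-- Density of the squared Bessel process of parameter γ started at 0. -/
def sqBessel (γ s t : ℝ) : ℝ :=
  Real.exp (-(s / (2 * t))) * s ^ (γ / 2 - 1) / ((2 * t) ^ (γ / 2) * Real.Gamma (γ / 2))

/-- State probabilities of the GCP at squared Bessel time. -/
def pbar (k : ℕ) (l : Fin k → ℝ) (γ : ℝ) (n : ℕ) (t : ℝ) : ℝ :=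
  ∫ s in Set.Ioi (0 : ℝ), gcp k l n s * sqBessel γ s t

lemma hasSum_congr_both {ι : Type*} {f g : ι → ℝ} {a b : ℝ} (h : HasSum g b)
    (hfg : f = g) (hab : a = b) : HasSum f a := by
  subst hfg hab; exact h

/-- Poisson weights. -/
def poisW (m : ℝ) (x : ℕ) : ℝ := m ^ x / (Nat.factorial x : ℝ) * Real.exp (-m)

lemma poisW_nonneg {m : ℝ} (hm : 0 ≤ m) (x : ℕ) : 0 ≤ poisW m x := by
  unfold poisW; positivity

lemma poisW_succ (m : ℝ) (x : ℕ) : ((x + 1 : ℕ) : ℝ) * poisW m (x + 1) = m * poisW m x := by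
  unfold poisW
  rw [Nat.factorial_succ]
  push_cast
  have h : (Nat.factorial x : ℝ) ≠ 0 := by positivity
  have h' : (x : ℝ) + 1 ≠ 0 := by positivity
  field_simp
  ring

lemma poisW_zeroth (m : ℝ) : HasSum (poisW m) 1 := by
  have h := NormedSpace.expSeries_div_hasSum_exp (𝔸 := ℝ) m
  rw [← Real.exp_eq_exp_ℝ] at h
  have h2 := h.mul_right (Real.exp (-m))
  rw [← Real.exp_add, add_neg_cancel, Real.exp_zero] at h2
  exact h2

lemma poisW_first (m : ℝ) : HasSum (fun x : ℕ => (x : ℝ) * poisW m x) m := by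
  rw [← hasSum_nat_add_iff' 1]
  have h := (poisW_zeroth m).mul_left m
  refine hasSum_congr_both h ?_ ?_
  · funext x; exact poisW_succ m x
  · simp

lemma poisW_second (m : ℝ) : HasSum (fun x : ℕ => (x : ℝ) ^ 2 * poisW m x) (m + m ^ 2) := by
  rw [← hasSum_nat_add_iff' 1]
  have h := ((poisW_zeroth m).mul_left m).add ((poisW_first m).mul_left m)
  refine hasSum_congr_both h ?_ ?_
  · funext x
    have := poisW_succ m x
    rw [pow_two, mul_assoc, this]
    push_cast
    ring
  · simp; ring

lemma hasSum_prod_nonneg {ι κ : Type*} {f : ι → ℝ} {g : κ → ℝ} {a b : ℝ}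
    (hf : HasSum f a) (hg : HasSum g b) (hf0 : ∀ i, 0 ≤ f i) (hg0 : ∀ i, 0 ≤ g i) :
    HasSum (fun p : ι × κ => f p.1 * g p.2) (a * b) :=
  hf.mul hg (hf.summable.mul_of_nonneg hg.summable hf0 hg0)

lemma multi_moments (k : ℕ) : ∀ (a m : Fin k → ℝ), (∀ j, 0 ≤ a j) → (∀ j, 0 ≤ m j) →
    HasSum (fun x : Fin k → ℕ => ∏ j, poisW (m j) (x j)) 1 ∧
    HasSum (fun x : Fin k → ℕ => (∑ j, a j * x j) * ∏ j, poisW (m j) (x j)) (∑ j, a j * m j) ∧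
    HasSum (fun x : Fin k → ℕ => (∑ j, a j * x j) ^ 2 * ∏ j, poisW (m j) (x j))
      (∑ j, a j ^ 2 * m j + (∑ j, a j * m j) ^ 2) := by
  induction k with
  | zero =>
    intro a m _ _
    refine ⟨?_, ?_, ?_⟩
    · simpa using hasSum_unique (fun x : Fin 0 → ℕ => (1 : ℝ))
    · simpa using hasSum_unique (fun x : Fin 0 → ℕ => (0 : ℝ))
    · simpa using hasSum_unique (fun x : Fin 0 → ℕ => (0 : ℝ))
  | succ k ih =>
    intro a m ha hm
    obtain ⟨h0, h1, h2⟩ := ih (fun j => a j.succ) (fun j => m j.succ)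
      (fun j => ha _) (fun j => hm _)
    have g0 := poisW_zeroth (m 0)
    have g1 := poisW_first (m 0)
    have g2 := poisW_second (m 0)
    have pg : ∀ x, 0 ≤ poisW (m 0) x := poisW_nonneg (hm 0)
    have pg1 : ∀ x : ℕ, 0 ≤ (x : ℝ) * poisW (m 0) x := fun x => mul_nonneg (by positivity) (pg x)
    have pg2 : ∀ x : ℕ, 0 ≤ (x : ℝ) ^ 2 * poisW (m 0) x :=
      fun x => mul_nonneg (by positivity) (pg x)
    have ph : ∀ x : Fin k → ℕ, 0 ≤ ∏ j, poisW (m j.succ) (x j) :=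
      fun x => Finset.prod_nonneg fun j _ => poisW_nonneg (hm _) _
    have ps : ∀ x : Fin k → ℕ, 0 ≤ ∑ j, a j.succ * (x j : ℝ) :=
      fun x => Finset.sum_nonneg fun j _ => mul_nonneg (ha _) (by positivity)
    have ph1 := fun x => mul_nonneg (ps x) (ph x)
    have ph2 := fun x => mul_nonneg (pow_nonneg (ps x) 2) (ph x)
    refine ⟨?_, ?_, ?_⟩
    · rw [← (Fin.consEquiv (fun _ : Fin (k + 1) => ℕ)).hasSum_iff]
      refine hasSum_congr_both (hasSum_prod_nonneg g0 h0 pg ph) ?_ ?_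
      · funext p
        simp [Fin.prod_univ_succ, Fin.consEquiv]
      · simp
    · rw [← (Fin.consEquiv (fun _ : Fin (k + 1) => ℕ)).hasSum_iff]
      refine hasSum_congr_both (((hasSum_prod_nonneg g1 h0 pg1 ph).mul_left (a 0)).add
        (hasSum_prod_nonneg g0 h1 pg ph1)) ?_ ?_
      · funext p
        simp [Fin.prod_univ_succ, Fin.sum_univ_succ, Fin.consEquiv]
        ring
      · simp [Fin.sum_univ_succ]
    · rw [← (Fin.consEquiv (fun _ : Fin (k + 1) => ℕ)).hasSum_iff]
      refine hasSum_congr_both ((((hasSum_prod_nonneg g2 h0 pg2 ph).mul_left (a 0 ^ 2)).add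
        ((hasSum_prod_nonneg g1 h1 pg1 ph1).mul_left (2 * a 0))).add
        (hasSum_prod_nonneg g0 h2 pg ph2)) ?_ ?_
      · funext p
        simp [Fin.prod_univ_succ, Fin.sum_univ_succ, Fin.consEquiv]
        ring
      · simp [Fin.sum_univ_succ]
        ring

lemma mem_Omega (k n : ℕ) (x : Fin k → ℕ) :
    x ∈ Omega k n ↔ ∑ j, (j.val + 1) * x j = n := by
  unfold Omega
  simp only [Finset.mem_filter, Fintype.mem_piFinset, Finset.mem_range, and_iff_right_iff_imp]
  intro h j
  have h1 : (j.val + 1) * x j ≤ ∑ j, (j.val + 1) * x j :=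
    Finset.single_le_sum (f := fun j : Fin k => (j.val + 1) * x j)
      (fun _ _ => Nat.zero_le _) (Finset.mem_univ j)
  have h2 : x j ≤ (j.val + 1) * x j := Nat.le_mul_of_pos_left _ (Nat.succ_pos _)
  omega

lemma gcp_second (k : ℕ) (l : Fin k → ℝ) (hl : ∀ j, 0 < l j) (s : ℝ) (hs : 0 ≤ s) :
    HasSum (fun n : ℕ => (n : ℝ) ^ 2 * gcp k l n s)
      ((∑ j, ((j.val + 1 : ℝ)) ^ 2 * l j) * s + (∑ j, (j.val + 1 : ℝ) * l j) ^ 2 * s ^ 2) := by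
  have h := (multi_moments k (fun j => (j.val + 1 : ℝ)) (fun j => l j * s)
    (fun j => by positivity) (fun j => mul_nonneg (hl j).le hs)).2.2
  have h2 := h.tsum_fiberwise (fun x : Fin k → ℕ => ∑ j, (j.val + 1) * x j)
  refine hasSum_congr_both h2 ?_ ?_
  · funext n
    have hset : (fun x : Fin k → ℕ => ∑ j, (j.val + 1) * x j) ⁻¹' {n} = ↑(Omega k n) := by
      ext x
      simp [mem_Omega]
    rw [hset, Finset.tsum_subtype' (Omega k n) (fun x : Fin k → ℕ =>
      (∑ j : Fin k, (j.val + 1 : ℝ) * x j) ^ 2 * ∏ j, poisW (l j * s) (x j))]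
    unfold gcp
    rw [Finset.mul_sum]
    refine Finset.sum_congr rfl fun x hx => ?_
    rw [mem_Omega] at hx
    rw [← hx]
    push_cast
    rfl
  · simp only [← mul_assoc, ← Finset.sum_mul]
    ring

lemma sqBessel_moment (γ t p : ℝ) (hγ : 0 < γ) (ht : 0 < t) (hp : 0 ≤ p) :
    IntegrableOn (fun s => s ^ p * sqBessel γ s t) (Set.Ioi 0) ∧
    ∫ s in Set.Ioi (0 : ℝ), s ^ p * sqBessel γ s t =
      (2 * t) ^ p * Real.Gamma (γ / 2 + p) / Real.Gamma (γ / 2) := by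
  have hG := Real.Gamma_pos_of_pos (half_pos hγ)
  have hG2 := Real.Gamma_pos_of_pos (show 0 < γ / 2 + p by linarith)
  have h2t : 0 < 2 * t := by linarith
  have key : ∫ s in Set.Ioi (0 : ℝ), s ^ p * sqBessel γ s t =
      (2 * t) ^ p * Real.Gamma (γ / 2 + p) / Real.Gamma (γ / 2) := by
    have h := Real.integral_rpow_mul_exp_neg_mul_Ioi (a := γ / 2 + p) (r := 1 / (2 * t))
      (by linarith) (by positivity)
    have : ∀ s ∈ Set.Ioi (0 : ℝ), s ^ p * sqBessel γ s t =
        (1 / ((2 * t) ^ (γ / 2) * Real.Gamma (γ / 2))) *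
          (s ^ (γ / 2 + p - 1) * Real.exp (-(1 / (2 * t) * s))) := by
      intro s hs
      unfold sqBessel
      rw [show γ / 2 + p - 1 = p + (γ / 2 - 1) by ring, Real.rpow_add hs,
        show 1 / (2 * t) * s = s / (2 * t) by ring]
      ring
    rw [setIntegral_congr_fun measurableSet_Ioi this, integral_const_mul, h, one_div_one_div,
      Real.rpow_add h2t]
    have : (2 * t) ^ (γ / 2) ≠ 0 := by positivity
    field_simp
  refine ⟨?_, key⟩
  by_contra hcon
  have h0 := integral_undef hcon
  rw [key] at h0
  have : 0 < (2 * t) ^ p * Real.Gamma (γ / 2 + p) / Real.Gamma (γ / 2) := by positivity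
  linarith

lemma sqBessel_nonneg (γ s t : ℝ) (hγ : 0 < γ) (ht : 0 < t) (hs : 0 < s) :
    0 ≤ sqBessel γ s t := by
  have hG := Real.Gamma_pos_of_pos (half_pos hγ)
  unfold sqBessel
  positivity

lemma gcp_nonneg (k : ℕ) (l : Fin k → ℝ) (hl : ∀ j, 0 < l j) (n : ℕ) (s : ℝ) (hs : 0 ≤ s) :
    0 ≤ gcp k l n s :=
  Finset.sum_nonneg fun x _ => Finset.prod_nonneg fun j _ =>
    poisW_nonneg (mul_nonneg (hl j).le hs) _

theorem gcp_sqBessel_var (k : ℕ) (hk : 1 ≤ k) (l : Fin k → ℝ) (hl : ∀ j, 0 < l j)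
    (c₁ c₂ : ℝ) (hc₁ : c₁ = ∑ j, (j.val + 1 : ℝ) * l j)
    (hc₂ : c₂ = ∑ j, ((j.val + 1 : ℝ)) ^ 2 * l j)
    (γ t : ℝ) (hγ : 0 < γ) (ht : 0 < t) :
    (∑' n : ℕ, (n : ℝ) ^ 2 * pbar k l γ n t) - (c₁ * γ * t) ^ 2 =
      c₂ * γ * t + 2 * γ * (c₁ * t) ^ 2 := by
  obtain ⟨i1, m1⟩ := sqBessel_moment γ t 1 hγ ht (by norm_num)
  obtain ⟨i2, m2⟩ := sqBessel_moment γ t 2 hγ ht (by norm_num)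
  have hG := Real.Gamma_pos_of_pos (half_pos hγ)
  have G1 : Real.Gamma (γ / 2 + 1) = γ / 2 * Real.Gamma (γ / 2) :=
    Real.Gamma_add_one (by positivity)
  have G2 : Real.Gamma (γ / 2 + 2) = (γ / 2 + 1) * (γ / 2 * Real.Gamma (γ / 2)) := by
    rw [← G1, ← Real.Gamma_add_one (by positivity)]
    congr 1; ring
  rw [G1] at m1
  rw [G2] at m2
  simp only [Real.rpow_one, Real.rpow_two] at i1 i2 m1 m2
  have hsum : ∀ s ∈ Set.Ioi (0 : ℝ),
      HasSum (fun n : ℕ => (n : ℝ) ^ 2 * (gcp k l n s * sqBessel γ s t))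
      (c₂ * (s * sqBessel γ s t) + c₁ ^ 2 * (s ^ 2 * sqBessel γ s t)) := by
    intro s hs
    have h := (gcp_second k l hl s (le_of_lt hs)).mul_right (sqBessel γ s t)
    rw [← hc₁, ← hc₂] at h
    refine hasSum_congr_both h ?_ ?_
    · funext n; ring
    · ring
  have hint : IntegrableOn
      (fun s => c₂ * (s * sqBessel γ s t) + c₁ ^ 2 * (s ^ 2 * sqBessel γ s t)) (Set.Ioi 0) :=
    (i1.const_mul c₂).add (i2.const_mul (c₁ ^ 2))
  have main := hasSum_integral_of_dominated_convergence (μ := volume.restrict (Set.Ioi (0 : ℝ)))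
    (F := fun (n : ℕ) s => (n : ℝ) ^ 2 * (gcp k l n s * sqBessel γ s t))
    (f := fun s => c₂ * (s * sqBessel γ s t) + c₁ ^ 2 * (s ^ 2 * sqBessel γ s t))
    (fun (n : ℕ) s => (n : ℝ) ^ 2 * (gcp k l n s * sqBessel γ s t))
    (by
      intro n
      apply Measurable.aestronglyMeasurable
      unfold gcp sqBessel
      fun_prop)
    (by
      intro n
      filter_upwards [ae_restrict_mem measurableSet_Ioi] with s hs
      rw [Real.norm_of_nonneg]
      exact mul_nonneg (by positivity) (mul_nonneg (gcp_nonneg k l hl n s (le_of_lt hs))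
        (sqBessel_nonneg γ s t hγ ht hs)))
    (by
      filter_upwards [ae_restrict_mem measurableSet_Ioi] with s hs
      exact (hsum s hs).summable)
    (by
      refine hint.congr ?_
      filter_upwards [ae_restrict_mem measurableSet_Ioi] with s hs
      exact (hsum s hs).tsum_eq.symm)
    (by
      filter_upwards [ae_restrict_mem measurableSet_Ioi] with s hs
      exact hsum s hs)
  simp only [integral_const_mul] at main
  rw [integral_add (i1.const_mul c₂) (i2.const_mul (c₁ ^ 2)), integral_const_mul,
    integral_const_mul, m1, m2] at main
  have := main.tsum_eq
  unfold pbar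
  rw [this]
  field_simp
  ring
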